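/- Fix n ∈ ℕ, a segment length T ∈ ℕ with T ≥ 1, constants α ∈ (0,1), μ ≥ 1, p_min > 0, p_max > 0, e ≥ 0, and set α̂ := α·μ^{1/T}; assume α̂ < 1. Let η : ℕ → ℝ^n and let P : ℕ → (symmetric real n×n matrices) satisfy, for all i ∈ ℕ: p_min I_n ⪯ P(i) ⪯ p_max I_n and P(i+1) ⪯ μ·P(i). Suppose that for every k ∈ ℕ, with i := k / T (natural-number floor division), √(η(k+1)ᵀ P(i) η(k+1)) ≤ √α · √(η(k)ᵀ P(i) η(k)) + √(p_max)·e. Then for every k ∈ ℕ, ‖η(k)‖ ≤ √(p_max/p_min) · α̂^{k/2} · ‖η(0)‖ + √(p_max/p_min) · ((α̂/α)^{T/2} / (1 − √α̂)) · e. -/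

import Mathlib

open Matrix

/-- A sequence with `y (k + 1) ≤ s * y k + d` and `0 ≤ s < 1` decays geometrically up to
the residual `d / (1 - s)`. -/
theorem le_geometric_add_residual {y : ℕ → ℝ} {s d : ℝ} (hs0 : 0 ≤ s) (hs1 : s < 1)
    (hd : 0 ≤ d) (h : ∀ k, y (k + 1) ≤ s * y k + d) (k : ℕ) :
    y k ≤ s ^ k * y 0 + d / (1 - s) := by
  have hs : 0 < 1 - s := by linarith
  induction k with
  | zero => simpa using div_nonneg hd hs.le
  | succ k ih =>
    calc y (k + 1) ≤ s * y k + d := h k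
      _ ≤ s * (s ^ k * y 0 + d / (1 - s)) + d := by gcongr
      _ = s ^ (k + 1) * y 0 + d / (1 - s) := by field_simp; ring

/-- Switched scalar decay: the `i`-th gauge `q i` contracts by `a` per step on the `i`-th
segment of length `T`, and switching to the next gauge costs at most a factor `b ^ T`. -/
theorem le_of_segmentwise_decay {q : ℕ → ℕ → ℝ} {T : ℕ} (hT : 1 ≤ T) {a b c : ℝ}
    (ha : 0 ≤ a) (hb : 1 ≤ b) (hab : a * b < 1) (hc : 0 ≤ c) (hq : ∀ i k, 0 ≤ q i k)
    (hstep : ∀ k, q (k / T) (k + 1) ≤ a * q (k / T) k + c)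
    (hswitch : ∀ i k, q (i + 1) k ≤ b ^ T * q i k) (k : ℕ) :
    q (k / T) k ≤ (a * b) ^ k * q 0 0 + b ^ T * c / (1 - a * b) := by
  have hb0 : 0 ≤ b := by linarith
  have hy := le_geometric_add_residual (y := fun k => b ^ (k % T) * q (k / T) k)
    (s := a * b) (d := b ^ T * c) (by positivity) hab (by positivity) (fun k => ?_) k
  · simp only [Nat.zero_mod, Nat.zero_div, pow_zero, one_mul] at hy
    exact (le_mul_of_one_le_left (hq _ _) (one_le_pow₀ hb)).trans hy
  · have hlt : k % T < T := Nat.mod_lt _ hT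
    by_cases hk : T ∣ k + 1
    · have hr : k % T + 1 = T := by
        have := (Nat.dvd_iff_mod_eq_zero).1 hk
        rw [Nat.add_mod_eq_ite] at this
        rcases hT.eq_or_lt with rfl | h1
        · omega
        · rw [Nat.mod_eq_of_lt h1] at this
          split_ifs at this; omega
      have hpow : b ^ T = b ^ (k % T) * b := by rw [← pow_succ, hr]
      simp only [Nat.succ_div_of_dvd hk, Nat.mod_eq_zero_of_dvd hk, pow_zero, one_mul]
      calc q (k / T + 1) (k + 1) ≤ b ^ T * q (k / T) (k + 1) := hswitch _ _
        _ ≤ b ^ T * (a * q (k / T) k + c) := by gcongr; exact hstep k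
        _ = a * b * (b ^ (k % T) * q (k / T) k) + b ^ T * c := by rw [hpow]; ring
    · have hr : (k + 1) % T = k % T + 1 := by
        have h1 := Nat.div_add_mod k T
        have h2 := Nat.div_add_mod (k + 1) T
        rw [Nat.succ_div_of_not_dvd hk] at h2
        omega
      simp only [Nat.succ_div_of_not_dvd hk, hr]
      calc b ^ (k % T + 1) * q (k / T) (k + 1)
          ≤ b ^ (k % T + 1) * (a * q (k / T) k + c) := by gcongr; exact hstep k
        _ = a * b * (b ^ (k % T) * q (k / T) k) + b ^ (k % T + 1) * c := by ring
        _ ≤ a * b * (b ^ (k % T) * q (k / T) k) + b ^ T * c := by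
            gcongr
            omega

/-- The Loewner order bounds quadratic forms pointwise. -/
theorem dotProduct_mulVec_le_of_posSemidef_sub {n : ℕ} {A B : Matrix (Fin n) (Fin n) ℝ}
    (h : (B - A).PosSemidef) (v : Fin n → ℝ) : v ⬝ᵥ A *ᵥ v ≤ v ⬝ᵥ B *ᵥ v := by
  have := h.dotProduct_mulVec_nonneg v
  rw [sub_mulVec, dotProduct_sub, star_trivial] at this
  linarith

theorem dotProduct_smul_one_mulVec_self {n : ℕ} (c : ℝ) (v : EuclideanSpace ℝ (Fin n)) :
    v ⬝ᵥ (c • (1 : Matrix (Fin n) (Fin n) ℝ)) *ᵥ v = c * ‖v‖ ^ 2 := by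
  rw [smul_mulVec, one_mulVec, dotProduct_smul, smul_eq_mul, EuclideanSpace.real_norm_sq_eq]
  simp [dotProduct, sq]

/-- **Theorem 2 (Practical exponential stability within funnels).**
Segments have length `T ≥ 1`; `P(i)` are symmetric with `p_min I ⪯ P(i) ⪯ p_max I` and
cross-segment growth `P(i+1) ⪯ μ P(i)`; the per-step Lyapunov bound
`√(η(k+1)ᵀ P_i η(k+1)) ≤ √α √(η(k)ᵀ P_i η(k)) + √p_max · e` holds with `i = ⌊k/T⌋`;
and the effective rate `α̂ = α μ^(1/T)` satisfies `α̂ < 1`. Then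
`‖η(k)‖ ≤ √(p_max/p_min) α̂^(k/2) ‖η(0)‖
  + √(p_max/p_min) ((α̂/α)^(T/2)/(1 − √α̂)) e`. -/
theorem practical_exponential_stability {n : ℕ} (T : ℕ) (hT : 1 ≤ T)
    (α μ pmin pmax e : ℝ)
    (hα0 : 0 < α) (hα1 : α < 1) (hμ : 1 ≤ μ)
    (hpmin : 0 < pmin) (hpmax : 0 < pmax) (he : 0 ≤ e)
    (hhat : α * μ ^ (1 / (T : ℝ)) < 1)
    (η : ℕ → EuclideanSpace ℝ (Fin n))
    (P : ℕ → Matrix (Fin n) (Fin n) ℝ)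
    (hsymm : ∀ i, (P i).IsSymm)
    (hlow : ∀ i, (P i - pmin • (1 : Matrix (Fin n) (Fin n) ℝ)).PosSemidef)
    (hhigh : ∀ i, (pmax • (1 : Matrix (Fin n) (Fin n) ℝ) - P i).PosSemidef)
    (hgrow : ∀ i, (μ • P i - P (i + 1)).PosSemidef)
    (hstep : ∀ k : ℕ,
      Real.sqrt (η (k + 1) ⬝ᵥ (P (k / T)).mulVec (η (k + 1))) ≤
        Real.sqrt α * Real.sqrt (η k ⬝ᵥ (P (k / T)).mulVec (η k)) +
          Real.sqrt pmax * e) :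
    ∀ k : ℕ,
      ‖η k‖ ≤
        Real.sqrt (pmax / pmin) * (α * μ ^ (1 / (T : ℝ))) ^ ((k : ℝ) / 2) * ‖η 0‖ +
        Real.sqrt (pmax / pmin) *
          ((α * μ ^ (1 / (T : ℝ)) / α) ^ ((T : ℝ) / 2) /
            (1 - Real.sqrt (α * μ ^ (1 / (T : ℝ))))) * e := by
  have hT0 : (T : ℝ) ≠ 0 := by positivity
  have hμ0 : 0 < μ := by linarith
  set β := μ ^ (1 / (T : ℝ)) with hβ
  have hβ1 : 1 ≤ β := Real.one_le_rpow hμ (by positivity)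
  have hβ0 : 0 < β := by linarith
  have hβT : √β ^ T = √μ := by
    have hpow : β ^ T = μ := by
      rw [hβ, ← Real.rpow_mul_natCast hμ0.le, one_div_mul_cancel hT0, Real.rpow_one]
    rw [← hpow, eq_comm, Real.sqrt_eq_iff_mul_self_eq_of_pos (by positivity), ← mul_pow,
      Real.mul_self_sqrt hβ0.le]
  have hαβ : √α * √β = √(α * β) := (Real.sqrt_mul hα0.le β).symm
  have hlt : √(α * β) < 1 := by rw [Real.sqrt_lt' one_pos]; simpa using hhat
  have sqrt_form (c : ℝ) (hc : 0 < c) (v : EuclideanSpace ℝ (Fin n)) :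
      √(v ⬝ᵥ (c • (1 : Matrix (Fin n) (Fin n) ℝ)) *ᵥ v) = √c * ‖v‖ := by
    rw [dotProduct_smul_one_mulVec_self, Real.sqrt_mul hc.le, Real.sqrt_sq (norm_nonneg v)]
  intro k
  have key := le_of_segmentwise_decay (q := fun i k => √(η k ⬝ᵥ P i *ᵥ η k)) hT
    (Real.sqrt_nonneg α) (Real.one_le_sqrt.2 hβ1) (hαβ ▸ hlt)
    (c := √pmax * e) (by positivity) (fun _ _ => Real.sqrt_nonneg _) hstep
    (fun i k => ?_) k
  · have hk : √pmin * ‖η k‖ ≤ √(η k ⬝ᵥ P (k / T) *ᵥ η k) := by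
      rw [← sqrt_form pmin hpmin]
      exact Real.sqrt_le_sqrt (dotProduct_mulVec_le_of_posSemidef_sub (hlow _) _)
    have h0 : √(η 0 ⬝ᵥ P 0 *ᵥ η 0) ≤ √pmax * ‖η 0‖ := by
      rw [← sqrt_form pmax hpmax]
      exact Real.sqrt_le_sqrt (dotProduct_mulVec_le_of_posSemidef_sub (hhigh _) _)
    have hrate : (α * β) ^ ((k : ℝ) / 2) = √(α * β) ^ k := by
      rw [Real.sqrt_eq_rpow, ← Real.rpow_mul_natCast (by positivity)]
      ring_nf
    have hgain : (α * β / α) ^ ((T : ℝ) / 2) = √μ := by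
      rw [mul_div_cancel_left₀ β hα0.ne', ← hβT, Real.sqrt_eq_rpow,
        ← Real.rpow_mul_natCast hβ0.le]
      ring_nf
    have hpm : 0 < √pmin := Real.sqrt_pos.2 hpmin
    rw [hrate, hgain, Real.sqrt_div hpmax.le]
    rw [hαβ, hβT] at key
    refine le_of_mul_le_mul_left ?_ hpm
    calc √pmin * ‖η k‖ ≤ _ := hk.trans key
      _ ≤ √(α * β) ^ k * (√pmax * ‖η 0‖) + √μ * (√pmax * e) / (1 - √(α * β)) := by gcongr
      _ = _ := by field_simp
  · rw [hβT, ← Real.sqrt_mul hμ0.le]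
    refine Real.sqrt_le_sqrt ?_
    have := dotProduct_mulVec_le_of_posSemidef_sub (hgrow i) (η k)
    rwa [smul_mulVec, dotProduct_smul, smul_eq_mul] at this
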